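/- arXiv:2506.20035 — 2 statements merged into one kernel-verified Lean document; each statement's English description precedes it below -/
import Mathlib

section
/- For every x ∈ ℝ and every J ∈ ℕ, the tail of the squared coefficient sequence of the shifted Gaussian kernel satisfies the geometric bound Σ_{j=J}^∞ η_j² χ_j(x)² φ_{1+σ²}(x)² ≤ (1/(2π)) · (σ²/(1+σ²))^J. -/
open MeasureTheory Real

/-- Density of the normal distribution `N(0, s2)` with variance `s2`. -/
noncomputable def gauss (s2 t : ℝ) : ℝ :=
  (Real.sqrt (2 * Real.pi * s2))⁻¹ * Real.exp (-t ^ 2 / (2 * s2))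

/-- The `j`-th probabilist's Hermite polynomial. -/
noncomputable def He (j : ℕ) (t : ℝ) : ℝ :=
  ∑ l ∈ Finset.range (j / 2 + 1),
    (-1 : ℝ) ^ l * ((Nat.factorial (2 * l) : ℝ) / ((2 : ℝ) ^ l * (Nat.factorial l : ℝ))) *
      (Nat.choose j (2 * l) : ℝ) * t ^ (j - 2 * l)

/-- `ψ_j(t) = He_j(t/σ)/√(j!)`. -/
noncomputable def ψ (σ : ℝ) (j : ℕ) (t : ℝ) : ℝ :=
  He j (t / σ) / Real.sqrt (Nat.factorial j)

/-- `χ_j(x) = He_j(x/√(1+σ²))/√(j!)`. -/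
noncomputable def χ (σ : ℝ) (j : ℕ) (x : ℝ) : ℝ :=
  He j (x / Real.sqrt (1 + σ ^ 2)) / Real.sqrt (Nat.factorial j)

/-- `η_j = (σ²/(1+σ²))^{j/2}`. -/
noncomputable def η (σ : ℝ) (j : ℕ) : ℝ :=
  Real.sqrt (σ ^ 2 / (1 + σ ^ 2)) ^ j

open Polynomial in
/-- The Hermite polynomials form an Appell sequence. -/
lemma derivative_hermite_succ (n : ℕ) :
    derivative (hermite (n + 1)) = ((n : ℤ[X]) + 1) * hermite n := by
  induction n with
  | zero => simp
  | succ n ih =>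
    rw [hermite_succ (n + 1), ih]
    simp only [derivative_sub, derivative_mul, derivative_X, derivative_add, derivative_natCast,
      derivative_one]
    rw [ih, hermite_succ n]
    push_cast
    ring

open Polynomial in
lemma hasDerivAt_aeval_hermite_succ (n : ℕ) (t : ℝ) :
    HasDerivAt (fun y : ℝ => aeval y (hermite (n + 1)))
      (((n : ℝ) + 1) * aeval t (hermite n)) t := by
  have h := (hermite (n + 1)).hasDerivAt_aeval (𝕜 := ℝ) t
  rw [derivative_hermite_succ] at h
  simpa using h

open Polynomial in
lemma hasDerivAt_aeval_hermite (n : ℕ) (t : ℝ) :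
    HasDerivAt (fun y : ℝ => aeval y (hermite n))
      (t * aeval t (hermite n) - aeval t (hermite (n + 1))) t := by
  refine ((hermite n).hasDerivAt_aeval (𝕜 := ℝ) t).congr_deriv ?_
  simp [hermite_succ]

open Polynomial in
/-- The value at `0` of the energy `He_{n+1}² + (n + 1) He_n²` is at most `(n + 1)!`. -/
lemma hermite_energy_zero_le (n : ℕ) :
    aeval (0 : ℝ) (hermite (n + 1)) ^ 2 + ((n : ℝ) + 1) * aeval (0 : ℝ) (hermite n) ^ 2
      ≤ Nat.factorial (n + 1) := by
  induction n with
  | zero => simp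
  | succ n ih =>
    have h : aeval (0 : ℝ) (hermite (n + 2)) = -(((n : ℝ) + 1) * aeval (0 : ℝ) (hermite n)) := by
      rw [hermite_succ (n + 1), derivative_hermite_succ]
      simp
    rw [h, Nat.factorial_succ (n + 1)]
    push_cast
    have hn : (0 : ℝ) ≤ n := n.cast_nonneg
    nlinarith [mul_le_mul_of_nonneg_left ih (by positivity : (0 : ℝ) ≤ n + 1 + 1),
      mul_nonneg (by positivity : (0 : ℝ) ≤ n + 1) (sq_nonneg (aeval (0 : ℝ) (hermite n)))]

open Polynomial in
/-- A weak form of Cramér's inequality for Hermite polynomials. -/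
lemma aeval_hermite_sq_le (n : ℕ) (y : ℝ) :
    aeval y (hermite n) ^ 2 * Real.exp (-y ^ 2) ≤ Nat.factorial n := by
  cases n with
  | zero => simp [sq_nonneg]
  | succ n =>
    set V : ℝ → ℝ := fun t => (aeval t (hermite (n + 1)) ^ 2 +
      ((n : ℝ) + 1) * aeval t (hermite n) ^ 2) * Real.exp (-t ^ 2) with hV
    have hd (t : ℝ) : HasDerivAt V
        (-2 * t * (aeval t (hermite (n + 1)) ^ 2 * Real.exp (-t ^ 2))) t := by
      have h : HasDerivAt V _ t := (((hasDerivAt_aeval_hermite_succ n t).pow 2).add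
        (((hasDerivAt_aeval_hermite n t).pow 2).const_mul ((n : ℝ) + 1))).mul
        (((hasDerivAt_id t).pow 2).neg.exp)
      refine h.congr_deriv ?_
      simp
      ring
    have hc : Continuous V := continuous_iff_continuousAt.2 fun t => (hd t).continuousAt
    have hdiff : Differentiable ℝ V := fun t => (hd t).differentiableAt
    have h0 : V y ≤ V 0 := by
      rcases le_total 0 y with hy | hy
      · refine antitoneOn_of_deriv_nonpos (convex_Ici 0) hc.continuousOn hdiff.differentiableOn
          (fun t ht => ?_) Set.self_mem_Ici hy hy
        rw [interior_Ici] at ht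
        rw [(hd t).deriv]
        have : 0 < t := ht
        exact mul_nonpos_of_nonpos_of_nonneg (by linarith) (by positivity)
      · refine monotoneOn_of_deriv_nonneg (convex_Iic 0) hc.continuousOn hdiff.differentiableOn
          (fun t ht => ?_) hy Set.self_mem_Iic hy
        rw [interior_Iic] at ht
        rw [(hd t).deriv]
        have : t < 0 := ht
        exact mul_nonneg (by linarith) (by positivity)
    have h1 : V 0 ≤ Nat.factorial (n + 1) := by simpa [hV] using hermite_energy_zero_le n
    have h2 : aeval y (hermite (n + 1)) ^ 2 * Real.exp (-y ^ 2) ≤ V y :=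
      mul_le_mul_of_nonneg_right (le_add_of_nonneg_right (by positivity)) (Real.exp_pos _).le
    exact h2.trans (h0.trans h1)

lemma factorial_two_mul_div (l : ℕ) :
    (Nat.factorial (2 * l) : ℝ) / ((2 : ℝ) ^ l * (Nat.factorial l : ℝ)) =
      (Nat.doubleFactorial (2 * l - 1) : ℝ) := by
  rw [div_eq_iff (by positivity)]
  cases l with
  | zero => simp
  | succ l =>
    have h1 := Nat.factorial_eq_mul_doubleFactorial (2 * l + 1)
    have h2 := Nat.doubleFactorial_two_mul (l + 1)
    have h3 : 2 * (l + 1) - 1 = 2 * l + 1 := by omega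
    rw [h3, mul_comm (Nat.doubleFactorial _ : ℝ), show 2 * (l + 1) = 2 * l + 1 + 1 by ring, h1,
      show 2 * l + 1 + 1 = 2 * (l + 1) by ring, h2]
    push_cast
    ring

open Polynomial in
lemma He_eq_aeval_hermite (j : ℕ) (t : ℝ) : He j t = aeval t (hermite j) := by
  rw [aeval_eq_sum_range, natDegree_hermite, He]
  refine Finset.sum_of_injOn (fun l => j - 2 * l) ?_ ?_ ?_ ?_
  · intro a ha b hb h
    simp only [Finset.coe_range, Set.mem_Iio] at ha hb
    simp only at h
    omega
  · intro a ha
    simp only [Finset.coe_range, Set.mem_Iio] at ha ⊢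
    omega
  · intro k hk hk'
    rw [coeff_hermite_of_odd_add, zero_smul]
    rw [← Nat.not_even_iff_odd]
    rintro ⟨m, hm⟩
    rw [Finset.mem_range] at hk
    refine hk' ⟨j - m, ?_, ?_⟩
    · simp only [Finset.coe_range, Set.mem_Iio]
      omega
    · simp only
      omega
  · intro l hl
    rw [Finset.mem_range] at hl
    obtain ⟨k, rfl⟩ : ∃ k, j = 2 * l + k := ⟨j - 2 * l, by omega⟩
    rw [factorial_two_mul_div, Nat.add_sub_cancel_left, coeff_hermite_explicit,
      Nat.choose_symm_add]
    simp [zsmul_eq_mul]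

lemma tail_coefficient_le (σ x : ℝ) (n : ℕ) :
    η σ n ^ 2 * (χ σ n x * gauss (1 + σ ^ 2) x) ^ 2 ≤
      1 / (2 * Real.pi) * (1 - σ ^ 2 / (1 + σ ^ 2)) * (σ ^ 2 / (1 + σ ^ 2)) ^ n := by
  have hs : 0 < 1 + σ ^ 2 := by positivity
  have hη : η σ n ^ 2 = (σ ^ 2 / (1 + σ ^ 2)) ^ n := by
    rw [η, ← pow_mul, mul_comm, pow_mul, Real.sq_sqrt (by positivity)]
  have hg : gauss (1 + σ ^ 2) x ^ 2 = 1 / (2 * Real.pi) * (1 - σ ^ 2 / (1 + σ ^ 2)) *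
      Real.exp (-(x / Real.sqrt (1 + σ ^ 2)) ^ 2) := by
    rw [gauss, mul_pow, inv_pow, Real.sq_sqrt (by positivity), ← Real.exp_nat_mul, div_pow,
      Real.sq_sqrt hs.le]
    congr 1
    · field_simp
      ring
    · congr 1
      push_cast
      field_simp
  have hχ : χ σ n x ^ 2 * Real.exp (-(x / Real.sqrt (1 + σ ^ 2)) ^ 2) ≤ 1 := by
    rw [χ, div_pow, Real.sq_sqrt (by positivity), div_mul_eq_mul_div,
      div_le_one (by positivity), He_eq_aeval_hermite]
    exact aeval_hermite_sq_le n _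
  have hq : 0 ≤ 1 - σ ^ 2 / (1 + σ ^ 2) := by
    rw [sub_nonneg, div_le_one hs]
    linarith
  rw [hη, mul_pow, hg]
  calc _ = (1 / (2 * Real.pi) * (1 - σ ^ 2 / (1 + σ ^ 2)) * (σ ^ 2 / (1 + σ ^ 2)) ^ n) *
        (χ σ n x ^ 2 * Real.exp (-(x / Real.sqrt (1 + σ ^ 2)) ^ 2)) := by ring
    _ ≤ _ := mul_le_of_le_one_right (by positivity) hχ

/-- Geometric bound on the tail of the squared coefficient sequence of the
shifted Gaussian kernel. -/
theorem tail_coefficient_geometric_bound (σ : ℝ) (hσ : 0 < σ) (x : ℝ) (J : ℕ) :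
    Summable (fun j : ℕ => η σ (J + j) ^ 2 * (χ σ (J + j) x * gauss (1 + σ ^ 2) x) ^ 2) ∧
    (∑' j : ℕ, η σ (J + j) ^ 2 * (χ σ (J + j) x * gauss (1 + σ ^ 2) x) ^ 2) ≤
      (1 / (2 * Real.pi)) * (σ ^ 2 / (1 + σ ^ 2)) ^ J := by
  have hs : 0 < 1 + σ ^ 2 := by positivity
  have hq0 : 0 ≤ σ ^ 2 / (1 + σ ^ 2) := by positivity
  have hq1 : σ ^ 2 / (1 + σ ^ 2) < 1 := by
    rw [div_lt_one hs]
    linarith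
  have hgeom : HasSum (fun j : ℕ => 1 / (2 * Real.pi) * (1 - σ ^ 2 / (1 + σ ^ 2)) *
      (σ ^ 2 / (1 + σ ^ 2)) ^ (J + j)) (1 / (2 * Real.pi) * (σ ^ 2 / (1 + σ ^ 2)) ^ J) := by
    have h := (hasSum_geometric_of_lt_one hq0 hq1).mul_left
      (1 / (2 * Real.pi) * (1 - σ ^ 2 / (1 + σ ^ 2)) * (σ ^ 2 / (1 + σ ^ 2)) ^ J)
    rw [mul_right_comm (1 / (2 * Real.pi)), mul_inv_cancel_right₀ (sub_pos.2 hq1).ne'] at h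
    refine h.congr_fun fun j => ?_
    rw [pow_add]
    ring
  have hsum := Summable.of_nonneg_of_le (fun j => by positivity)
    (fun j => tail_coefficient_le σ x (J + j)) hgeom.summable
  exact ⟨hsum, hasSum_le (fun j => tail_coefficient_le σ x (J + j)) hsum.hasSum hgeom⟩
end

section
/- Let f be a bounded measurable probability density on ℝ. Then the infimum of ‖f − φ∗π‖_Y over π ∈ F_∞ equals the infimum of ‖f − φ⋆Π‖_Y over all probability measures Π on ℝ, where (φ⋆Π)(t) = ∫_ℝ φ(t−h) dΠ(h); i.e., restricting the projection to continuous (bounded-density) mixing distributions does not change the infimum. -/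
open MeasureTheory Real

/-- `F_∞`: bounded measurable probability densities on `ℝ`. -/
def IsBoundedDensity (g : ℝ → ℝ) : Prop :=
  Measurable g ∧ (∀ x, 0 ≤ g x) ∧ (∫ x, g x) = 1 ∧
    ∃ C : ℝ, ∀ᵐ x ∂(volume : Measure ℝ), g x ≤ C

/-- The weighted norm `‖g‖_Y = (∫ g(t)² φ_{σ²}(t) dt)^{1/2}`. -/
noncomputable def ynorm (σ : ℝ) (g : ℝ → ℝ) : ℝ :=
  Real.sqrt (∫ t, g t ^ 2 * gauss (σ ^ 2) t)

lemma gauss_nonneg (s2 t : ℝ) : 0 ≤ gauss s2 t := by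
  unfold gauss; positivity

lemma gauss_le {s2 : ℝ} (hs : 0 ≤ s2) (t : ℝ) : gauss s2 t ≤ (√(2 * π * s2))⁻¹ := by
  unfold gauss
  refine mul_le_of_le_one_right (by positivity) (Real.exp_le_one_iff.2 ?_)
  exact div_nonpos_of_nonpos_of_nonneg (neg_nonpos.2 (sq_nonneg t)) (by positivity)

@[fun_prop]
lemma continuous_gauss (s2 : ℝ) : Continuous (gauss s2) := by
  unfold gauss; fun_prop

lemma integrable_gauss {s2 : ℝ} (hs : 0 < s2) : Integrable (gauss s2) := by
  have h := (integrable_exp_neg_mul_sq (b := (2 * s2)⁻¹) (by positivity)).const_mul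
    (√(2 * π * s2))⁻¹
  refine h.congr (Filter.Eventually.of_forall fun t => ?_)
  simp only [gauss]
  congr 2
  field_simp

lemma integral_gauss_sub_nonneg (P : Measure ℝ) (t : ℝ) :
    0 ≤ ∫ h, gauss 1 (t - h) ∂P :=
  integral_nonneg fun _ => gauss_nonneg _ _

lemma integral_gauss_sub_le (P : Measure ℝ) [IsProbabilityMeasure P] (t : ℝ) :
    ∫ h, gauss 1 (t - h) ∂P ≤ (√(2 * π * 1))⁻¹ := by
  have h := integral_mono_of_nonneg (μ := P) (f := fun h => gauss 1 (t - h))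
    (g := fun _ => (√(2 * π * 1))⁻¹) (Filter.Eventually.of_forall fun _ => gauss_nonneg _ _)
    (integrable_const _) (Filter.Eventually.of_forall fun _ => gauss_le zero_le_one _)
  simpa using h

/-- Mixing with a bounded density is mixing with the probability measure having that density. -/
lemma IsBoundedDensity.exists_measure {p : ℝ → ℝ} (hp : IsBoundedDensity p) :
    ∃ P : Measure ℝ, IsProbabilityMeasure P ∧
      ∀ t, ∫ h, gauss 1 (t - h) ∂P = ∫ h, gauss 1 (t - h) * p h := by
  obtain ⟨hm, h0, h1, -⟩ := hp
  have hi : Integrable p := by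
    by_contra h
    simp [integral_undef h] at h1
  refine ⟨volume.withDensity fun x => ENNReal.ofReal (p x), ⟨?_⟩, fun t => ?_⟩
  · rw [withDensity_apply _ MeasurableSet.univ, Measure.restrict_univ,
      ← ofReal_integral_eq_lintegral_ofReal hi (Filter.Eventually.of_forall h0), h1,
      ENNReal.ofReal_one]
  · rw [integral_withDensity_eq_integral_toReal_smul hm.ennreal_ofReal
      (Filter.Eventually.of_forall fun _ => ENNReal.ofReal_lt_top)]
    simp [ENNReal.toReal_ofReal (h0 _), mul_comm]

/-- A probability measure dominated by a multiple of Lebesgue measure has a bounded density. -/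
lemma exists_isBoundedDensity_of_le_smul {P : Measure ℝ} [IsProbabilityMeasure P] {c : ENNReal}
    (hc : c ≠ ⊤) (hP : P ≤ c • volume) :
    ∃ p, IsBoundedDensity p ∧
      ∀ t, ∫ h, gauss 1 (t - h) * p h = ∫ h, gauss 1 (t - h) ∂P := by
  have hac : P ≪ volume :=
    (Measure.absolutelyContinuous_of_le hP).trans Measure.smul_absolutelyContinuous
  refine ⟨fun x => (P.rnDeriv volume x).toReal, ⟨by fun_prop, fun _ => ENNReal.toReal_nonneg,
    ?_, c.toReal, ?_⟩, fun t => ?_⟩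
  · simp [Measure.integral_toReal_rnDeriv hac]
  · have h : P.rnDeriv volume ≤ᵐ[volume] fun _ => c := by
      refine ae_le_of_forall_setLIntegral_le_of_sigmaFinite (by fun_prop) fun s hs _ => ?_
      rw [Measure.setLIntegral_rnDeriv hac]
      simpa using hP s
    filter_upwards [h] with x hx using ENNReal.toReal_mono hc hx
  · rw [← integral_rnDeriv_smul hac]
    simp [mul_comm]

/-- The law of `X + (n + 1)⁻¹ U`, where `X ∼ P` and `U` is uniform on `[0, 1]`, independent
of `X`. -/
noncomputable def smoothing (P : Measure ℝ) (n : ℕ) : Measure ℝ :=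
  (P.prod (volume.restrict (Set.Icc (0 : ℝ) 1))).map fun z => z.1 + ((n : ℝ) + 1)⁻¹ * z.2

instance isProbabilityMeasure_volume_restrict_Icc :
    IsProbabilityMeasure (volume.restrict (Set.Icc (0 : ℝ) 1)) := ⟨by simp⟩

instance (P : Measure ℝ) [IsProbabilityMeasure P] (n : ℕ) :
    IsProbabilityMeasure (smoothing P n) :=
  Measure.isProbabilityMeasure_map (by fun_prop)

lemma smoothing_le (P : Measure ℝ) [IsProbabilityMeasure P] (n : ℕ) :
    smoothing P n ≤ ENNReal.ofReal ((n : ℝ) + 1) • volume := by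
  have hn : (0 : ℝ) < (n : ℝ) + 1 := by positivity
  refine Measure.le_iff.2 fun s hs => ?_
  have hmeas : Measurable fun z : ℝ × ℝ => z.1 + ((n : ℝ) + 1)⁻¹ * z.2 := by fun_prop
  rw [smoothing, Measure.map_apply hmeas hs, Measure.prod_apply (hmeas hs)]
  calc _ ≤ ∫⁻ _, ENNReal.ofReal ((n : ℝ) + 1) * volume s ∂P := by
        refine lintegral_mono fun x => (Measure.restrict_apply_le _ _).trans ?_
        have : Prod.mk x ⁻¹' ((fun z : ℝ × ℝ => z.1 + ((n : ℝ) + 1)⁻¹ * z.2) ⁻¹' s)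
            = (((n : ℝ) + 1)⁻¹ * ·) ⁻¹' ((x + ·) ⁻¹' s) := rfl
        rw [this, Real.volume_preimage_mul_left (by positivity), measure_preimage_add, inv_inv,
          abs_of_pos hn]
    _ = _ := by simp

lemma tendsto_integral_gauss_smoothing (P : Measure ℝ) [IsProbabilityMeasure P] (t : ℝ) :
    Filter.Tendsto (fun n => ∫ h, gauss 1 (t - h) ∂(smoothing P n)) Filter.atTop
      (nhds (∫ h, gauss 1 (t - h) ∂P)) := by
  have h1 : ∀ n, ∫ h, gauss 1 (t - h) ∂(smoothing P n)
      = ∫ z, gauss 1 (t - (z.1 + ((n : ℝ) + 1)⁻¹ * z.2))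
        ∂(P.prod (volume.restrict (Set.Icc (0 : ℝ) 1))) := fun n =>
    integral_map (by fun_prop)
      (Continuous.aestronglyMeasurable (f := fun h => gauss 1 (t - h)) (by fun_prop))
  have h2 : ∫ h, gauss 1 (t - h) ∂P
      = ∫ z, gauss 1 (t - z.1) ∂(P.prod (volume.restrict (Set.Icc (0 : ℝ) 1))) := by
    rw [integral_fun_fst (fun h => gauss 1 (t - h))]
    simp
  simp_rw [h1, h2]
  refine tendsto_integral_of_dominated_convergence (fun _ => (√(2 * π * 1))⁻¹) (fun n =>
    Continuous.aestronglyMeasurable (by fun_prop)) (integrable_const _) (fun n =>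
    Filter.Eventually.of_forall fun z => ?_) (Filter.Eventually.of_forall fun z => ?_)
  · rw [Real.norm_of_nonneg (gauss_nonneg _ _)]
    exact gauss_le zero_le_one _
  · have h : Filter.Tendsto (fun n : ℕ => t - (z.1 + ((n : ℝ) + 1)⁻¹ * z.2)) Filter.atTop
        (nhds (t - (z.1 + 0 * z.2))) := by
      refine tendsto_const_nhds.sub (tendsto_const_nhds.add (Filter.Tendsto.mul_const _ ?_))
      simpa using tendsto_one_div_add_atTop_nhds_zero_nat (𝕜 := ℝ)
    simpa [Function.comp_def] using ((continuous_gauss 1).tendsto _).comp h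

/-- Dominated convergence for the weighted norm of `f - G n`. -/
lemma tendsto_ynorm_sub {σ : ℝ} (hσ : 0 < σ) {f : ℝ → ℝ} (hf : IsBoundedDensity f) {B : ℝ}
    {G : ℕ → ℝ → ℝ} {g : ℝ → ℝ} (hGm : ∀ n, StronglyMeasurable (G n))
    (hG0 : ∀ n t, 0 ≤ G n t) (hGB : ∀ n t, G n t ≤ B)
    (hlim : ∀ t, Filter.Tendsto (fun n => G n t) Filter.atTop (nhds (g t))) :
    Filter.Tendsto (fun n => ynorm σ fun t => f t - G n t) Filter.atTop
      (nhds (ynorm σ fun t => f t - g t)) := by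
  obtain ⟨hm, h0, -, C, hC⟩ := hf
  unfold ynorm
  refine (continuous_sqrt.tendsto _).comp ?_
  refine tendsto_integral_of_dominated_convergence
    (fun t => (C + B) ^ 2 * gauss (σ ^ 2) t) (fun n => ?_)
    ((integrable_gauss (by positivity)).const_mul _) (fun n => ?_)
    (Filter.Eventually.of_forall fun t => ?_)
  · exact (((hm.stronglyMeasurable.sub (hGm n)).pow 2).mul
      (continuous_gauss _).stronglyMeasurable).aestronglyMeasurable
  · filter_upwards [hC] with t ht
    rw [Real.norm_of_nonneg (mul_nonneg (sq_nonneg _) (gauss_nonneg _ _))]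
    refine mul_le_mul_of_nonneg_right (sq_le_sq' ?_ ?_) (gauss_nonneg _ _)
    · linarith [h0 t, hGB n t]
    · linarith [hG0 n t, hGB n t]
  · exact ((tendsto_const_nhds.sub (hlim t)).pow 2).mul_const _

/-- Restricting the projection to bounded-density mixing distributions does not
change the infimum: the infimum of `‖f − φ∗π‖_Y` over `π ∈ F_∞` equals the
infimum of `‖f − φ⋆Π‖_Y` over all probability measures `Π`. -/
theorem projection_inf_density_eq_inf_measure (σ : ℝ) (hσ : 0 < σ) (f : ℝ → ℝ)
    (hf : IsBoundedDensity f) :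
    sInf {r : ℝ | ∃ p : ℝ → ℝ, IsBoundedDensity p ∧
        r = ynorm σ (fun t => f t - ∫ h, gauss 1 (t - h) * p h)} =
      sInf {r : ℝ | ∃ P : Measure ℝ, IsProbabilityMeasure P ∧
        r = ynorm σ (fun t => f t - ∫ h, gauss 1 (t - h) ∂P)} := by
  have hbdd : ∀ s : Set ℝ, (∀ r ∈ s, 0 ≤ r) → BddBelow s := fun s hs => ⟨0, hs⟩
  refine le_antisymm (le_csInf ⟨_, Measure.dirac 0, inferInstance, rfl⟩ ?_)
    (csInf_le_csInf (hbdd _ ?_) ⟨_, f, hf, rfl⟩ ?_)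
  · rintro _ ⟨P, hP, rfl⟩
    choose p hp hpP using fun n =>
      exists_isBoundedDensity_of_le_smul ENNReal.ofReal_ne_top (smoothing_le P n)
    refine ge_of_tendsto' (tendsto_ynorm_sub hσ hf (fun n => ?_)
      (fun n => integral_gauss_sub_nonneg (smoothing P n))
      (fun n => integral_gauss_sub_le (smoothing P n))
      (tendsto_integral_gauss_smoothing P)) fun n => csInf_le (hbdd _ ?_) ⟨p n, hp n, ?_⟩
    · exact StronglyMeasurable.integral_prod_right
        (f := fun t h => gauss 1 (t - h))
        (Continuous.stronglyMeasurable (by unfold Function.uncurry; fun_prop))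
    · rintro _ ⟨_, -, rfl⟩
      exact Real.sqrt_nonneg _
    · simp_rw [hpP]
  · rintro _ ⟨_, -, rfl⟩
    exact Real.sqrt_nonneg _
  · rintro _ ⟨p, hp, rfl⟩
    obtain ⟨P, hP, h⟩ := hp.exists_measure
    exact ⟨P, hP, by simp_rw [h]⟩
end
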